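/- arXiv:2006.06852 — 3 statements merged into one kernel-verified Lean document; each statement's English description precedes it below -/
import Mathlib

section
/- Let T be a finite nonempty set, let θ : T → ℝ be nonnegative, let μ : T → ℝ be strictly positive, let C ≥ 0, and let p > 0. Then the supremum of (∑_{t∈T} P(t)·θ(t)) / (∑_{t∈T} P(t)·μ(t) + C) over all functions P : T → ℝ with P(t) ≥ 0 for all t and ∑_{t∈T} P(t) = p is attained at a point mass: there exists t* ∈ T such that the supremum equals p·θ(t*)/(p·μ(t*) + C), achieved by P = p·δ_{t*}. In particular, the optimal deadline randomization for each group is deterministic (Proposition 3 of the paper). -/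
open Finset Classical

open scoped Classical

/-- If every point mass of size `p` has reward rate at most `r`, so does every distribution of
total mass `p`. -/
theorem sum_mul_div_le_of_forall_div_le {T : Type*} [Fintype T] {θ μ P : T → ℝ} {C p r : ℝ}
    (hμ : ∀ t, 0 < μ t) (hC : 0 ≤ C) (hp : 0 < p) (hP : ∀ t, 0 ≤ P t) (hsum : ∑ t, P t = p)
    (hr : ∀ t, p * θ t / (p * μ t + C) ≤ r) :
    (∑ t, P t * θ t) / ((∑ t, P t * μ t) + C) ≤ r := by
  have hpos : 0 < (∑ t, P t * μ t) + C := by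
    obtain ⟨t, ht, hPt⟩ : ∃ t ∈ univ, 0 < P t :=
      exists_lt_of_sum_lt (by simpa [hsum] using hp)
    exact add_pos_of_pos_of_nonneg
      (sum_pos' (fun i _ => mul_nonneg (hP i) (hμ i).le) ⟨t, ht, mul_pos hPt (hμ t)⟩) hC
  rw [div_le_iff₀ hpos]
  refine le_of_mul_le_mul_left ?_ hp
  calc p * ∑ t, P t * θ t = ∑ t, P t * (p * θ t) := by
        rw [mul_sum]
        exact sum_congr rfl fun t _ => by ring
    _ ≤ ∑ t, P t * (r * (p * μ t + C)) := by
        refine sum_le_sum fun t _ => mul_le_mul_of_nonneg_left ?_ (hP t)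
        have := hμ t
        exact (div_le_iff₀ (by positivity)).1 (hr t)
    _ = ∑ t, (r * p * (P t * μ t) + r * C * P t) := sum_congr rfl fun t _ => by ring
    _ = p * (r * ((∑ t, P t * μ t) + C)) := by
        rw [sum_add_distrib, ← mul_sum, ← mul_sum, hsum]
        ring

/-- Proposition 3 (Optimal Deadline Policy), core optimization content:
the supremum of the reward-rate ratio over distributions of mass `p` on a finite
deadline set is attained at a point mass. -/
theorem optimal_deadline_deterministic
    {T : Type*} [Fintype T] [Nonempty T]
    (θ μ : T → ℝ) (hθ : ∀ t, 0 ≤ θ t) (hμ : ∀ t, 0 < μ t)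
    (C : ℝ) (hC : 0 ≤ C) (p : ℝ) (hp : 0 < p) :
    ∃ tstar : T,
      (∀ P : T → ℝ, (∀ t, 0 ≤ P t) → (∑ t, P t) = p →
        (∑ t, P t * θ t) / ((∑ t, P t * μ t) + C)
          ≤ p * θ tstar / (p * μ tstar + C)) ∧
      ((∑ t, (if t = tstar then p else 0) * θ t) /
          ((∑ t, (if t = tstar then p else 0) * μ t) + C)
        = p * θ tstar / (p * μ tstar + C)) := by
  obtain ⟨tstar, hmax⟩ := Finite.exists_max fun t => p * θ t / (p * μ t + C)
  exact ⟨tstar, fun P hP hsum => sum_mul_div_le_of_forall_div_le hμ hC hp hP hsum hmax,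
    by simp⟩
end

section
/- Let (X_i)_{i=1}^n and (R_i)_{i=1}^n be sequences of real-valued random variables on a probability space with X_i > 0 almost surely, common means E[X_i] = μ_X > 0 and E[R_i] = μ_R ≥ 0, and suppose that for every ε > 0 the tail bounds P(|∑_{i=1}^n X_i − n μ_X| > n ε) ≤ 2 exp(−n ε²/σ_X²) and P(|∑_{i=1}^n R_i − n μ_R| > n ε) ≤ 2 exp(−n ε²/σ_R²) hold for constants σ_X², σ_R² > 0. Then for every ε ∈ (0, μ_X), every r ≥ μ_R/μ_X, and every μ with 0 < μ ≤ μ_X − ε: P( |(∑_{i=1}^n R_i)/(∑_{i=1}^n X_i) − μ_R/μ_X| > ε(1+r)/μ ) ≤ 2(exp(−n ε²/σ_X²) + exp(−n ε²/σ_R²)). -/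
open MeasureTheory Finset

/-- If `S` and `T` are within `n * ε` of `n * a` and `n * b`, then `T / S` is close to `b / a`. -/
theorem abs_div_sub_div_le_of_abs_sub_le {n a b ε r m S T : ℝ} (hn : 0 < n) (ha : 0 < a)
    (hb : 0 ≤ b) (hε : 0 ≤ ε) (hr : b / a ≤ r) (hm : 0 < m) (hma : m ≤ a - ε)
    (hS : |S - n * a| ≤ n * ε) (hT : |T - n * b| ≤ n * ε) :
    |T / S - b / a| ≤ ε * (1 + r) / m := by
  have hq : 0 ≤ b / a := by positivity
  have hSm : n * m ≤ S := by
    have := mul_le_mul_of_nonneg_left hma hn.le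
    linarith [(abs_le.mp hS).1]
  have hSpos : 0 < S := (mul_pos hn hm).trans_le hSm
  have hsplit : T / S - b / a = ((T - n * b) - b / a * (S - n * a)) / S := by
    field_simp
    ring
  have hnum : |(T - n * b) - b / a * (S - n * a)| ≤ n * ε * (1 + r) :=
    calc |(T - n * b) - b / a * (S - n * a)|
        ≤ |T - n * b| + b / a * |S - n * a| := by
          simpa only [abs_mul, abs_of_nonneg hq] using abs_sub (T - n * b) (b / a * (S - n * a))
      _ ≤ n * ε + r * (n * ε) :=
          add_le_add hT (mul_le_mul hr hS (abs_nonneg _) (hq.trans hr))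
      _ = n * ε * (1 + r) := by ring
  have hr' : 0 ≤ 1 + r := by linarith
  rw [hsplit, abs_div, abs_of_pos hSpos]
  calc _ ≤ n * ε * (1 + r) / (n * m) := div_le_div₀ (by positivity) hnum (by positivity) hSm
    _ = ε * (1 + r) / m := by rw [mul_assoc, mul_div_mul_left _ _ hn.ne']

/-- Lemma 5 (appendix): concentration inequality for the ratio of sums of
sub-Gaussian random variables, where sub-Gaussianity is captured through
Hoeffding-type tail bounds on the centered sums. -/
theorem ratio_concentration
    {Ω : Type*} [MeasurableSpace Ω] (P : Measure Ω) [IsProbabilityMeasure P]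
    (n : ℕ) (hn : 1 ≤ n) (X R : Fin n → Ω → ℝ)
    (μX μR : ℝ) (hμX : 0 < μX) (hμR : 0 ≤ μR)
    (σX2 σR2 : ℝ) (hσX2 : 0 < σX2) (hσR2 : 0 < σR2)
    (hXpos : ∀ i, ∀ᵐ ω ∂P, 0 < X i ω)
    (hXmean : ∀ i, ∫ ω, X i ω ∂P = μX)
    (hRmean : ∀ i, ∫ ω, R i ω ∂P = μR)
    (hXtail : ∀ ε > (0:ℝ),
      P {ω | (n : ℝ) * ε < |(∑ i, X i ω) - (n : ℝ) * μX|}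
        ≤ ENNReal.ofReal (2 * Real.exp (-((n : ℝ) * ε ^ 2) / σX2)))
    (hRtail : ∀ ε > (0:ℝ),
      P {ω | (n : ℝ) * ε < |(∑ i, R i ω) - (n : ℝ) * μR|}
        ≤ ENNReal.ofReal (2 * Real.exp (-((n : ℝ) * ε ^ 2) / σR2)))
    (ε : ℝ) (hε : 0 < ε) (hεμX : ε < μX)
    (r : ℝ) (hr : μR / μX ≤ r)
    (μ : ℝ) (hμ : 0 < μ) (hμ' : μ ≤ μX - ε) :
    P {ω | ε * (1 + r) / μ < |(∑ i, R i ω) / (∑ i, X i ω) - μR / μX|}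
      ≤ ENNReal.ofReal
          (2 * (Real.exp (-((n : ℝ) * ε ^ 2) / σX2)
              + Real.exp (-((n : ℝ) * ε ^ 2) / σR2))) := by
  have hn' : (0 : ℝ) < n := by exact_mod_cast hn
  have hsub : {ω | ε * (1 + r) / μ < |(∑ i, R i ω) / (∑ i, X i ω) - μR / μX|} ⊆
      {ω | (n : ℝ) * ε < |(∑ i, X i ω) - (n : ℝ) * μX|} ∪
        {ω | (n : ℝ) * ε < |(∑ i, R i ω) - (n : ℝ) * μR|} := by
    intro ω hω
    by_contra h
    simp only [Set.mem_union, Set.mem_ofPred_eq, not_or, not_lt] at h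
    exact (abs_div_sub_div_le_of_abs_sub_le hn' hμX hμR hε.le hr hμ hμ' h.1 h.2).not_gt hω
  rw [mul_add 2, ENNReal.ofReal_add (by positivity) (by positivity)]
  exact (measure_mono hsub).trans <| (measure_union_le _ _).trans <|
    add_le_add (hXtail ε hε) (hRtail ε hε)
end

section
/- Let μ_X > 0, μ_R ≥ 0, ε ∈ (0, μ_X), r ≥ μ_R/μ_X, and 0 < μ ≤ μ_X − ε. If real numbers x, y satisfy |x − μ_X| ≤ ε and |y − μ_R| ≤ ε, then x > 0 and |y/x − μ_R/μ_X| ≤ ε(1+r)/μ. -/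
/-- Deterministic perturbation bound behind the ratio concentration lemma:
if `x` and `y` are each within `ε` of the true means `μX` and `μR`, then the
ratio `y/x` is within `ε*(1+r)/μ` of `μR/μX`. -/
theorem ratio_perturbation_bound
    (μX μR ε r μ x y : ℝ)
    (hμX : 0 < μX) (hμR : 0 ≤ μR)
    (hε : 0 < ε) (hεμX : ε < μX)
    (hr : μR / μX ≤ r)
    (hμ : 0 < μ) (hμ' : μ ≤ μX - ε)
    (hx : |x - μX| ≤ ε) (hy : |y - μR| ≤ ε) :
    0 < x ∧ |y / x - μR / μX| ≤ ε * (1 + r) / μ := by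
  have hμx : μ ≤ x := by linarith [(abs_le.mp hx).1]
  have hx0 : 0 < x := hμ.trans_le hμx
  have hq : 0 ≤ μR / μX := div_nonneg hμR hμX.le
  have key : y / x - μR / μX = ((y - μR) - μR / μX * (x - μX)) / x := by
    field_simp
    ring
  have hnum : |(y - μR) - μR / μX * (x - μX)| ≤ ε * (1 + r) := by
    calc |(y - μR) - μR / μX * (x - μX)|
        ≤ |y - μR| + |μR / μX * (x - μX)| := abs_sub _ _
      _ = |y - μR| + μR / μX * |x - μX| := by rw [abs_mul, abs_of_nonneg hq]
      _ ≤ ε + r * ε := by gcongr; exact hq.trans hr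
      _ = ε * (1 + r) := by ring
  refine ⟨hx0, ?_⟩
  rw [key, abs_div, abs_of_pos hx0]
  exact div_le_div₀ ((abs_nonneg _).trans hnum) hnum hμ hμx
end
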